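/- There is an algorithm that, given an integer k ≥ 2, a DFAO M generating a k-automatic sequence a = (a_n)_{n≥0}, a rational number r > 1, and a length l ≥ 1, decides whether a avoids all factors that are r-powers x^r with |x| ≥ l (resp., avoids all r^+-powers built from words x with |x| ≥ l). -/

import Mathlib

/-- Run an encoded DFAO transition table from state `q` on a list of base-`k`
digits, least significant digit first (this is `w^R` for a most-significant-first
representation `w`). -/
def dfaoRun (trans : List (List ℕ)) : ℕ → List ℕ → ℕ
  | q, [] => q
  | q, d :: ds => dfaoRun trans ((trans.getD q []).getD d 0) ds

/-- The encoded DFAO `(trans, q0, out)` over input alphabet `Σ_k = {0,…,k-1}`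
generates the sequence `a`: for every `m` and every base-`k` representation `w`
of `m` (given least significant digit first, possibly with trailing zeros,
all digits `< k`), the output on `w` is `a m`. -/
def dfaoGenerates (k : ℕ) (trans : List (List ℕ)) (q0 : ℕ) (out : List ℕ)
    (a : ℕ → ℕ) : Prop :=
  ∀ (m : ℕ) (w : List ℕ), (∀ d ∈ w, d < k) → Nat.ofDigits k w = m →
    a m = out.getD (dfaoRun trans q0 w) 0

/-- The factor `a_i a_{i+1} ⋯ a_{i+L-1}` of the sequence `a`. -/
def factorAt (a : ℕ → ℕ) (i L : ℕ) : List ℕ :=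
  (List.range L).map fun j => a (i + j)

/-- `w` is a factor of the infinite word `a`. -/
def IsFactorOf (a : ℕ → ℕ) (w : List ℕ) : Prop :=
  ∃ i : ℕ, w = factorAt a i w.length

/-- `z` is an `r`-power `x^r` for `r = p/q` built from a word `x` of length `T`:
`z` is the shortest prefix of `x^ω` of length `≥ (p/q)·T`, i.e. `z` has length
`⌈(p/q)·T⌉`, has period `T`, and `x` is its prefix of length `T`. -/
def IsRPowerOf (p q T : ℕ) (z : List ℕ) : Prop :=
  1 ≤ T ∧ T ≤ z.length ∧
    (∀ j : ℕ, j + T < z.length → z.getD j 0 = z.getD (j + T) 0) ∧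
    p * T ≤ q * z.length ∧ q * (z.length - 1) < p * T

/-- `z` is an `r⁺`-power for `r = p/q` built from a word `x` of length `T`:
`z` is the shortest prefix of `x^ω` of length `> (p/q)·T`. -/
def IsRPlusPowerOf (p q T : ℕ) (z : List ℕ) : Prop :=
  1 ≤ T ∧ T ≤ z.length ∧
    (∀ j : ℕ, j + T < z.length → z.getD j 0 = z.getD (j + T) 0) ∧
    p * T < q * z.length ∧ q * (z.length - 1) ≤ p * T

/-- `z` is an `r`-power for `r = p/q`. -/
def IsRPower (p q : ℕ) (z : List ℕ) : Prop :=
  ∃ T : ℕ, IsRPowerOf p q T z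

/-- `z` is an `r⁺`-power for `r = p/q`. -/
def IsRPlusPower (p q : ℕ) (z : List ℕ) : Prop :=
  ∃ T : ℕ, IsRPlusPowerOf p q T z

/-! ### Running the automaton -/

theorem dfaoRun_append (trans : List (List ℕ)) (s : ℕ) (u v : List ℕ) :
    dfaoRun trans s (u ++ v) = dfaoRun trans (dfaoRun trans s u) v := by
  induction u generalizing s with
  | nil => rfl
  | cons d u ih => exact ih _

/-- A strict upper bound for the states reachable from `q0`. -/
def stateBound (trans : List (List ℕ)) (q0 : ℕ) : ℕ :=
  q0 + trans.flatten.foldr (· + ·) 0 + 1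

theorem getD_getD_le_sum_flatten (trans : List (List ℕ)) (s d : ℕ) :
    (trans.getD s []).getD d 0 ≤ trans.flatten.foldr (· + ·) 0 := by
  rw [← List.sum_eq_foldr]
  by_cases hs : s < trans.length
  · rw [List.getD_eq_getElem _ _ hs]
    by_cases hd : d < trans[s].length
    · rw [List.getD_eq_getElem _ _ hd]
      exact List.le_sum_of_mem
        (List.mem_flatten.2 ⟨_, List.getElem_mem hs, List.getElem_mem hd⟩)
    · rw [List.getD_eq_default _ _ (not_lt.1 hd)]
      exact Nat.zero_le _
  · rw [List.getD_eq_default _ _ (not_lt.1 hs)]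
    exact Nat.zero_le _

theorem dfaoRun_lt_stateBound (trans : List (List ℕ)) (q0 s : ℕ) (w : List ℕ)
    (hs : s < stateBound trans q0) : dfaoRun trans s w < stateBound trans q0 := by
  induction w generalizing s with
  | nil => exact hs
  | cons d w ih =>
    refine ih _ ?_
    have := getD_getD_le_sum_flatten trans s d
    unfold stateBound
    omega

/-- Feed the least significant base-`k` digit of the second component to the automaton. -/
def digitStep (k : ℕ) (trans : List (List ℕ)) (x : ℕ × ℕ) : ℕ × ℕ :=
  ((trans.getD x.1 []).getD (x.2 % k) 0, x.2 / k)

/-- The `m`-th output of the automaton, computed by reading `m` digits of `m`. -/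
def dfaoEval (k : ℕ) (trans : List (List ℕ)) (q0 : ℕ) (out : List ℕ) (m : ℕ) : ℕ :=
  out.getD ((digitStep k trans)^[m] (q0, m)).1 0

theorem exists_digits_iterate_digitStep {k : ℕ} (hk : 0 < k) (trans : List (List ℕ)) (n m : ℕ) :
    ∃ w : List ℕ, (∀ d ∈ w, d < k) ∧ w.length = n ∧ Nat.ofDigits k w = m % k ^ n ∧
      ∀ s, ((digitStep k trans)^[n] (s, m)).1 = dfaoRun trans s w := by
  induction n generalizing m with
  | zero => exact ⟨[], by simp, rfl, by simp [Nat.mod_one], fun s => rfl⟩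
  | succ n ih =>
    obtain ⟨w, hw, hl, ho, hr⟩ := ih (m / k)
    refine ⟨m % k :: w, ?_, by simp [hl], ?_, fun s => ?_⟩
    · simpa using ⟨Nat.mod_lt _ hk, hw⟩
    · rw [Nat.ofDigits_cons, ho, pow_succ', Nat.mod_mul]
    · rw [Function.iterate_succ_apply]
      exact hr _

theorem dfaoEval_eq {k : ℕ} (hk : 2 ≤ k) {trans : List (List ℕ)} {q0 : ℕ} {out : List ℕ}
    {a : ℕ → ℕ} (h : dfaoGenerates k trans q0 out a) (m : ℕ) :
    dfaoEval k trans q0 out m = a m := by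
  obtain ⟨w, hw, -, ho, hr⟩ := exists_digits_iterate_digitStep (by omega : 0 < k) trans m m
  rw [Nat.mod_eq_of_lt (Nat.lt_pow_self (by omega))] at ho
  rw [h m w hw ho, dfaoEval, hr]

/-- The `k`-kernel of an automatic sequence is finite, with at most as many elements as there
are states. -/
theorem exists_kernel_enumeration {k : ℕ} (hk : 2 ≤ k) {trans : List (List ℕ)} {q0 : ℕ}
    {out : List ℕ} {a : ℕ → ℕ} (h : dfaoGenerates k trans q0 out a) :
    ∃ φ : ℕ → ℕ → ℕ, ∀ n r, r < k ^ n →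
      ∃ s < stateBound trans q0, ∀ x, a (r + k ^ n * x) = φ s x := by
  refine ⟨fun s x => out.getD (dfaoRun trans s (Nat.digits k x)) 0, fun n r hr => ?_⟩
  obtain ⟨w, hw, hl, ho, -⟩ := exists_digits_iterate_digitStep (by omega : 0 < k) trans n r
  rw [Nat.mod_eq_of_lt hr] at ho
  refine ⟨dfaoRun trans q0 w, dfaoRun_lt_stateBound _ _ _ _ (by unfold stateBound; omega),
    fun x => ?_⟩
  rw [h (r + k ^ n * x) (w ++ Nat.digits k x) ?_ ?_, dfaoRun_append]
  · intro d hd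
    rcases List.mem_append.1 hd with hd | hd
    · exact hw d hd
    · exact Nat.digits_lt_base (by omega) hd
  · rw [Nat.ofDigits_append, ho, hl, Nat.ofDigits_digits]

/-- Finite form of the kernel bound for arbitrary shifts of arithmetic subsequences. -/
theorem exists_finset_shifted_kernel {k : ℕ} (hk : 2 ≤ k) {trans : List (List ℕ)} {q0 : ℕ}
    {out : List ℕ} {a : ℕ → ℕ} (h : dfaoGenerates k trans q0 out a) :
    ∃ S : Finset (ℕ → ℕ), S.card ≤ stateBound trans q0 * 3 ∧
      ∀ n r, r < 3 * k ^ n → (fun x => a (r + k ^ n * x)) ∈ S := by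
  classical
  obtain ⟨φ, hφ⟩ := exists_kernel_enumeration hk h
  refine ⟨(Finset.range (stateBound trans q0) ×ˢ Finset.range 3).image
    fun se x => φ se.1 (x + se.2), Finset.card_image_le.trans (by simp), fun n r hr => ?_⟩
  have hpos : 0 < k ^ n := Nat.pow_pos (by omega)
  obtain ⟨s, hs, hsx⟩ := hφ n (r % k ^ n) (Nat.mod_lt _ hpos)
  refine Finset.mem_image.2 ⟨(s, r / k ^ n), ?_, ?_⟩
  · simpa [hs] using (Nat.div_lt_iff_lt_mul hpos).2 hr
  · funext x
    rw [← hsx]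
    congr 1
    conv_rhs => rw [← Nat.mod_add_div r (k ^ n)]
    ring

/-! ### Repetitions and their residual classes -/

/-- `a` has, at position `i`, a repetition of period `T ≥ l` whose excess over one period
consists of all `j` with `q * j < P * T + c`. -/
def HasRepetition (a : ℕ → ℕ) (q P c l T i : ℕ) : Prop :=
  l ≤ T ∧ ∀ j, q * j < P * T + c → a (i + j) = a (i + j + T)

/-- The constraints on the leading digits of the period and the position of a repetition
imposed by their lower digits `T₀` and `i₀` below `K`. -/
noncomputable def residualConstraints (a : ℕ → ℕ) (q P c K T₀ i₀ : ℕ) :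
    Finset ((ℕ → ℕ) × (ℕ → ℕ) × ℤ) :=
  open Classical in
  (Finset.range K).image fun j =>
    (fun x => a (i₀ + j + K * x), fun x => a (i₀ + j + T₀ + K * x),
      -((-((P * T₀ + c : ℤ) - q * j)) / K))

theorem mul_lt_mul_add_iff_lt_add_ceil {K : ℤ} (hK : 0 < K) (x y z : ℤ) :
    K * x < K * y + z ↔ x < y + -((-z) / K) := by
  have h := Int.ediv_lt_iff_lt_mul (a := -z) (b := y - x) hK
  have e : (y - x) * K = K * y - K * x := by ring
  rw [e] at h
  constructor
  · intro hx
    have := h.2 (by linarith)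
    linarith
  · intro hx
    have := h.1 (by linarith)
    linarith

theorem hasRepetition_iff_residual {a : ℕ → ℕ} {q P c l K : ℕ} (hK : 0 < K) (hl : l ≤ K)
    (T₀ i₀ T₁ i₁ : ℕ) :
    HasRepetition a q P c l (T₀ + K * T₁) (i₀ + K * i₁) ↔
      (1 ≤ T₁ ∨ l ≤ T₀) ∧ ∀ t ∈ residualConstraints a q P c K T₀ i₀, ∀ j : ℕ,
        (q * j : ℤ) < P * T₁ + t.2.2 → t.1 (i₁ + j) = t.2.1 (i₁ + j + T₁) := by
  unfold HasRepetition residualConstraints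
  refine and_congr ?_ ?_
  · rcases Nat.eq_zero_or_pos T₁ with rfl | hT
    · simp
    · have : K ≤ K * T₁ := Nat.le_mul_of_pos_right _ hT
      simp only [show 1 ≤ T₁ from hT, true_or, iff_true]
      omega
  · have key : ∀ j₀ j₁ : ℕ, q * (j₀ + K * j₁) < P * (T₀ + K * T₁) + c ↔
        (q * j₁ : ℤ) < P * T₁ + -((-((P * T₀ + c : ℤ) - q * j₀)) / K) := by
      intro j₀ j₁
      rw [← mul_lt_mul_add_iff_lt_add_ceil (by exact_mod_cast hK)]
      zify
      constructor <;> intro h <;> nlinarith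
    simp only [Finset.mem_image, Finset.mem_range, forall_exists_index, and_imp]
    constructor
    · rintro h _ j₀ hj₀ rfl j₁ hlt
      have := h (j₀ + K * j₁) ((key j₀ j₁).2 hlt)
      dsimp only
      convert this using 2 <;> ring
    · intro h j hj
      have hj' := Nat.mod_add_div j K
      rw [← hj'] at hj ⊢
      have := h _ (j % K) (Nat.mod_lt _ hK) rfl (j / K) ((key _ _).1 hj)
      dsimp only at this
      convert this using 2 <;> ring

/-- Two residual classes that agree allow the same leading digits. -/
theorem HasRepetition.transfer {a : ℕ → ℕ} {q P c l K K' : ℕ} (hK : 0 < K) (hl : l ≤ K)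
    (hK' : 0 < K') (hl' : l ≤ K') {T i : ℕ}
    (hcls : (residualConstraints a q P c K (T % K) (i % K), decide (l ≤ T % K)) =
      (residualConstraints a q P c K' (T % K') (i % K'), decide (l ≤ T % K')))
    (h : HasRepetition a q P c l T i) :
    HasRepetition a q P c l (T % K + K * (T / K')) (i % K + K * (i / K')) := by
  obtain ⟨h₁, h₂⟩ := Prod.mk.inj hcls
  rw [hasRepetition_iff_residual hK hl, h₁, decide_eq_decide.1 h₂,
    ← hasRepetition_iff_residual hK' hl', Nat.mod_add_div, Nat.mod_add_div]
  exact h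

/-- The number of residual classes, for an automaton with at most `M` states. -/
def residualBound (M p : ℕ) : ℕ :=
  2 ^ (M * 3 * (M * 3 * (p + 1))) * 2

theorem exists_finset_residualConstraints {k : ℕ} (hk : 2 ≤ k) {trans : List (List ℕ)} {q0 : ℕ}
    {out : List ℕ} {a : ℕ → ℕ} (h : dfaoGenerates k trans q0 out a) (q : ℕ) {P c : ℕ}
    (hP : 1 ≤ P) (hc : c ≤ 1) :
    ∃ S : Finset (Finset ((ℕ → ℕ) × (ℕ → ℕ) × ℤ) × Bool),
      S.card ≤ residualBound (stateBound trans q0) (q + P) ∧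
      ∀ n T₀ i₀, T₀ < k ^ n → i₀ < k ^ n → ∀ b,
        (residualConstraints a q P c (k ^ n) T₀ i₀, b) ∈ S := by
  classical
  obtain ⟨S, hcard, hS⟩ := exists_finset_shifted_kernel hk h
  refine ⟨(S ×ˢ S ×ˢ Finset.Icc (-(q : ℤ)) P).powerset ×ˢ Finset.univ, ?_, ?_⟩
  · have hI : (Finset.Icc (-(q : ℤ)) P).card = q + P + 1 := by
      rw [Int.card_Icc]
      omega
    rw [Finset.card_product, Finset.card_powerset, Finset.card_product, Finset.card_product, hI,
      Finset.card_univ, Fintype.card_bool, residualBound]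
    gcongr
    norm_num
  · intro n T₀ i₀ hT hi b
    simp only [Finset.mem_product, Finset.mem_powerset, Finset.mem_univ, and_true]
    intro t ht
    obtain ⟨j, hj, rfl⟩ := Finset.mem_image.1 ht
    rw [Finset.mem_range] at hj
    simp only [Finset.mem_product, Finset.mem_Icc]
    refine ⟨hS n _ (by omega), hS n _ (by omega), ?_, ?_⟩
    all_goals
      generalize hKdef : k ^ n = K at *
      have hK : (0 : ℤ) < K := by omega
    · have hq : (q : ℤ) * j ≤ q * K := by gcongr
      have : -((P * T₀ + c : ℤ) - q * j) / K ≤ q := by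
        refine Int.ediv_le_of_le_mul hK ?_
        have : (0 : ℤ) ≤ P * T₀ := by positivity
        have : (0 : ℤ) ≤ c := by positivity
        linarith
      linarith
    · have : -(P : ℤ) ≤ -((P * T₀ + c : ℤ) - q * j) / K := by
        refine (Int.le_ediv_iff_mul_le hK).2 ?_
        have h₁ : (P : ℤ) * (T₀ + 1) ≤ P * K := by
          have : (T₀ : ℤ) + 1 ≤ K := by omega
          gcongr
        have h₂ : (0 : ℤ) ≤ q * j := by positivity
        have h₃ : (c : ℤ) ≤ 1 := by omega
        have h₄ : (1 : ℤ) ≤ P := by omega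
        linarith
      linarith

/-- If some repetition exists, then one exists below an explicit bound. -/
theorem HasRepetition.exists_lt_pow {k : ℕ} (hk : 2 ≤ k) {trans : List (List ℕ)} {q0 : ℕ}
    {out : List ℕ} {a : ℕ → ℕ} (ha : dfaoGenerates k trans q0 out a) {q P c l : ℕ}
    (hP : 1 ≤ P) (hc : c ≤ 1) (h : ∃ T i, HasRepetition a q P c l T i) :
    ∃ T < k ^ (l + residualBound (stateBound trans q0) (q + P)),
      ∃ i < k ^ (l + residualBound (stateBound trans q0) (q + P)),
        HasRepetition a q P c l T i := by
  classical
  obtain ⟨S, hcard, hS⟩ := exists_finset_residualConstraints hk ha q hP hc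
  generalize residualBound (stateBound trans q0) (q + P) = C at hcard ⊢
  have hpos : ∀ n, 0 < k ^ n := fun n => Nat.pow_pos (by omega)
  have hex : ∃ m, ∃ T < k ^ m, ∃ i < k ^ m, HasRepetition a q P c l T i := by
    obtain ⟨T, i, h⟩ := h
    refine ⟨max T i, T, ?_, i, ?_, h⟩
    · exact (le_max_left _ _).trans_lt (Nat.lt_pow_self (by omega))
    · exact (le_max_right _ _).trans_lt (Nat.lt_pow_self (by omega))
  obtain ⟨T, hT, i, hi, hTi⟩ := Nat.find_spec hex
  have hmin := fun m => Nat.find_min (H := hex) (m := m)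
  generalize Nat.find hex = m at hT hi hmin
  by_cases hm : m ≤ l + C
  · have := Nat.pow_le_pow_right (by omega : 0 < k) hm
    exact ⟨T, by omega, i, by omega, hTi⟩
  exfalso
  let cls : ℕ → Finset ((ℕ → ℕ) × (ℕ → ℕ) × ℤ) × Bool := fun n =>
    (residualConstraints a q P c (k ^ n) (T % k ^ n) (i % k ^ n), decide (l ≤ T % k ^ n))
  obtain ⟨x, hx, y, hy, hxy, hcls⟩ := Finset.exists_ne_map_eq_of_card_lt_of_maps_to
    (s := Finset.Icc l (l + C)) (t := S) (f := cls) (by rw [Nat.card_Icc]; omega)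
    (fun n _ => hS n _ _ (Nat.mod_lt _ (hpos n)) (Nat.mod_lt _ (hpos n)) _)
  wlog hlt : x < y generalizing x y
  · exact this y hy x hx hxy.symm hcls.symm (by omega)
  rw [Finset.mem_Icc] at hx hy
  have hlk : ∀ n, l ≤ n → l ≤ k ^ n := fun n hn =>
    hn.trans (Nat.lt_pow_self (by omega)).le
  have hsmall : ∀ N, N < k ^ m → N % k ^ x + k ^ x * (N / k ^ y) < k ^ (x + (m - y)) := by
    intro N hN
    have h₁ : N / k ^ y < k ^ (m - y) := by
      rw [Nat.div_lt_iff_lt_mul (hpos y), ← pow_add]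
      convert hN using 2
      omega
    have h₂ := Nat.mod_lt N (hpos x)
    calc N % k ^ x + k ^ x * (N / k ^ y) < k ^ x + k ^ x * (N / k ^ y) := by omega
      _ = k ^ x * (N / k ^ y + 1) := by ring
      _ ≤ k ^ x * k ^ (m - y) := Nat.mul_le_mul_left _ h₁
      _ = k ^ (x + (m - y)) := (pow_add _ _ _).symm
  exact hmin (x + (m - y)) (by omega) ⟨_, hsmall T hT, _, hsmall i hi,
    hTi.transfer (hpos x) (hlk x hx.1) (hpos y) (hlk y hy.1) hcls⟩

/-! ### Powers as repetitions -/

theorem getD_factorAt (a : ℕ → ℕ) {i L j : ℕ} (hj : j < L) :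
    (factorAt a i L).getD j 0 = a (i + j) := by
  simp [factorAt, hj]

theorem exists_factor_period_iff_exists_hasRepetition (a : ℕ → ℕ) {p q l : ℕ} (c : ℕ)
    (hq : 1 ≤ q) (hp : q < p) (hl : 1 ≤ l) :
    (∃ w T, IsFactorOf a w ∧ l ≤ T ∧ 1 ≤ T ∧ T ≤ w.length ∧
      (∀ j, j + T < w.length → w.getD j 0 = w.getD (j + T) 0) ∧
      p * T + c ≤ q * w.length ∧ q * (w.length - 1) < p * T + c) ↔
    ∃ T i, HasRepetition a q (p - q) c l T i := by
  obtain ⟨P, rfl⟩ := Nat.exists_eq_add_of_lt hp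
  rw [show q + P + 1 - q = P + 1 by omega]
  constructor
  · rintro ⟨w, T, ⟨i, hi⟩, hlT, hT, hTw, hper, h₁, h₂⟩
    refine ⟨T, i, hlT, fun j hj => ?_⟩
    have hjT : j + T < w.length := by
      refine Nat.lt_of_mul_lt_mul_left (a := q) ?_
      nlinarith
    have := hper j hjT
    rw [hi, getD_factorAt a (by omega), getD_factorAt a hjT] at this
    rw [this, add_assoc]
  · rintro ⟨T, i, hlT, hrep⟩
    have hT : 1 ≤ T := hl.trans hlT
    obtain ⟨L, hL₁, hL₂⟩ : ∃ L, (q + P + 1) * T + c ≤ q * L ∧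
        q * (L - 1) < (q + P + 1) * T + c := by
      have hex : ∃ L, (q + P + 1) * T + c ≤ q * L :=
        ⟨(q + P + 1) * T + c, Nat.le_mul_of_pos_left _ hq⟩
      classical
      refine ⟨Nat.find hex, Nat.find_spec hex, not_le.1 (Nat.find_min hex ?_)⟩
      have : Nat.find hex ≠ 0 := by
        intro h₀
        have h := Nat.find_spec hex
        rw [h₀] at h
        nlinarith
      omega
    have hlen : (factorAt a i L).length = L := by simp [factorAt]
    refine ⟨factorAt a i L, T, ⟨i, by rw [hlen]⟩, hlT, hT, ?_, ?_, ?_, ?_⟩ <;> rw [hlen]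
    · have : q * T ≤ q * L := by nlinarith
      exact Nat.le_of_mul_le_mul_left this hq
    · intro j hj
      rw [getD_factorAt a (by omega), getD_factorAt a hj, ← add_assoc]
      refine hrep j ?_
      have : q * (j + T) ≤ q * (L - 1) := Nat.mul_le_mul_left _ (by omega)
      nlinarith
    · exact hL₁
    · exact hL₂

/-! ### The decision procedure -/

/-- Bounded search for a repetition: no period and position below the bound work. -/
def NoSmallRepetition (c k : ℕ) (trans : List (List ℕ)) (q0 : ℕ) (out : List ℕ) (p q l : ℕ) :
    Prop :=
  ∀ T < k ^ (l + residualBound (stateBound trans q0) p),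
    ∀ i < k ^ (l + residualBound (stateBound trans q0) p),
      ¬ (l ≤ T ∧ ∀ j < (p - q) * T + c, ¬ (q * j < (p - q) * T + c ∧
        ¬ dfaoEval k trans q0 out (i + j) = dfaoEval k trans q0 out (i + j + T)))

theorem noSmallRepetition_iff {k : ℕ} (hk : 2 ≤ k) {trans : List (List ℕ)} {q0 : ℕ}
    {out : List ℕ} {a : ℕ → ℕ} (ha : dfaoGenerates k trans q0 out a) {p q l c : ℕ}
    (hq : 1 ≤ q) (hp : q < p) (hc : c ≤ 1) :
    NoSmallRepetition c k trans q0 out p q l ↔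
      ¬ ∃ T i, HasRepetition a q (p - q) c l T i := by
  have hev : ∀ T i, (l ≤ T ∧ ∀ j < (p - q) * T + c, ¬ (q * j < (p - q) * T + c ∧
      ¬ dfaoEval k trans q0 out (i + j) = dfaoEval k trans q0 out (i + j + T))) ↔
      HasRepetition a q (p - q) c l T i := by
    intro T i
    refine and_congr_right fun _ => ?_
    simp only [dfaoEval_eq hk ha, not_and, not_not]
    exact ⟨fun h j hj => h j ((Nat.le_mul_of_pos_left j hq).trans_lt hj) hj,
      fun h j _ hj => h j hj⟩
  simp only [NoSmallRepetition, hev]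
  constructor
  · intro h hex
    obtain ⟨T, hT, i, hi, hr⟩ := HasRepetition.exists_lt_pow hk ha (by omega) hc hex
    rw [show q + (p - q) = p by omega] at hT hi
    exact h T hT i hi hr
  · exact fun h T _ i _ hr => h ⟨T, i, hr⟩

section Primrec

variable {α : Type*} [Primcodable α]

theorem Primrec.nat_pow : Primrec₂ ((· ^ ·) : ℕ → ℕ → ℕ) :=
  Primrec₂.unpaired'.1 Nat.Primrec.pow

theorem primrec_stateBound {t : α → List (List ℕ)} {s : α → ℕ} (ht : Primrec t)
    (hs : Primrec s) : Primrec fun x => stateBound (t x) (s x) := by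
  unfold stateBound
  refine Primrec.succ.comp (Primrec.nat_add.comp hs ?_)
  exact Primrec.list_foldr (Primrec.list_flatten.comp ht) (Primrec.const 0)
    (Primrec.nat_add.comp (Primrec.fst.comp Primrec.snd) (Primrec.snd.comp Primrec.snd)).to₂

theorem primrec_residualBound {M p : α → ℕ} (hM : Primrec M) (hp : Primrec p) :
    Primrec fun x => residualBound (M x) (p x) := by
  have h₃ := Primrec.nat_mul.comp hM (Primrec.const 3)
  exact Primrec.nat_mul.comp (Primrec.nat_pow.comp (Primrec.const 2)
    (Primrec.nat_mul.comp h₃ (Primrec.nat_mul.comp h₃ (Primrec.succ.comp hp)))) (Primrec.const 2)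

theorem primrec_dfaoEval {k : α → ℕ} {t : α → List (List ℕ)} {s : α → ℕ} {o : α → List ℕ}
    {m : α → ℕ} (hk : Primrec k) (ht : Primrec t) (hs : Primrec s) (ho : Primrec o)
    (hm : Primrec m) : Primrec fun x => dfaoEval (k x) (t x) (s x) (o x) (m x) := by
  unfold dfaoEval
  refine (Primrec.list_getD 0).comp ho (Primrec.fst.comp ?_)
  refine Primrec.nat_iterate hm (hs.pair hm) ?_
  refine Primrec.pair ?_ ?_
  · exact (Primrec.list_getD 0).comp
      ((Primrec.list_getD []).comp (ht.comp Primrec.fst) (Primrec.fst.comp Primrec.snd))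
      (Primrec.nat_mod.comp (Primrec.snd.comp Primrec.snd) (hk.comp Primrec.fst))
  · exact Primrec.nat_div.comp (Primrec.snd.comp Primrec.snd) (hk.comp Primrec.fst)

theorem PrimrecPred.forall_lt_comp {R : ℕ → α → Prop} {b : α → ℕ} (hb : Primrec b)
    (hR : PrimrecPred fun x : ℕ × α => R x.1 x.2) : PrimrecPred fun x => ∀ n < b x, R n x := by
  have h : PrimrecRel fun (n : ℕ) y => ∀ x < n, R x y :=
    ((PrimrecRel.forall_mem_list (R := R) hR).comp (Primrec.list_range.comp Primrec.fst)
      Primrec.snd).of_eq (by simp)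
  exact h.comp hb Primrec.id

end Primrec

open Primrec in
theorem primrecPred_noSmallRepetition (c : ℕ) :
    PrimrecPred fun x : ℕ × List (List ℕ) × ℕ × List ℕ × ℕ × ℕ × ℕ =>
      NoSmallRepetition c x.1 x.2.1 x.2.2.1 x.2.2.2.1 x.2.2.2.2.1 x.2.2.2.2.2.1
        x.2.2.2.2.2.2 := by
  let D := ℕ × List (List ℕ) × ℕ × List ℕ × ℕ × ℕ × ℕ
  have hk : Primrec fun x : D => x.1 := fst
  have ht : Primrec fun x : D => x.2.1 := fst.comp snd
  have hs : Primrec fun x : D => x.2.2.1 := fst.comp (snd.comp snd)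
  have ho : Primrec fun x : D => x.2.2.2.1 := fst.comp (snd.comp (snd.comp snd))
  have hp : Primrec fun x : D => x.2.2.2.2.1 := fst.comp (snd.comp (snd.comp (snd.comp snd)))
  have hq : Primrec fun x : D => x.2.2.2.2.2.1 :=
    fst.comp (snd.comp (snd.comp (snd.comp (snd.comp snd))))
  have hl : Primrec fun x : D => x.2.2.2.2.2.2 :=
    snd.comp (snd.comp (snd.comp (snd.comp (snd.comp snd))))
  have hB : Primrec fun x : D =>
      x.1 ^ (x.2.2.2.2.2.2 + residualBound (stateBound x.2.1 x.2.2.1) x.2.2.2.2.1) :=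
    nat_pow.comp hk (nat_add.comp hl (primrec_residualBound (primrec_stateBound ht hs) hp))
  refine PrimrecPred.forall_lt_comp hB ?_
  refine PrimrecPred.forall_lt_comp (hB.comp snd) ?_
  refine PrimrecPred.not (PrimrecPred.and ?_ ?_)
  · exact nat_le.comp (hl.comp (snd.comp snd)) (fst.comp snd)
  have hE : Primrec fun y : ℕ × ℕ × D =>
      (y.2.2.2.2.2.2.1 - y.2.2.2.2.2.2.2.1) * y.2.1 + c :=
    nat_add.comp (nat_mul.comp
      (nat_sub.comp (hp.comp (snd.comp snd)) (hq.comp (snd.comp snd))) (fst.comp snd)) (const c)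
  refine PrimrecPred.forall_lt_comp hE ?_
  have hd : Primrec fun y : ℕ × ℕ × ℕ × D => y.2.2.2 := snd.comp (snd.comp snd)
  have hij : Primrec fun y : ℕ × ℕ × ℕ × D => y.2.1 + y.1 := nat_add.comp (fst.comp snd) fst
  refine PrimrecPred.not (PrimrecPred.and ?_ (PrimrecPred.not ?_))
  · exact nat_lt.comp (nat_mul.comp (hq.comp hd) fst) (hE.comp snd)
  · exact Primrec.eq.comp
      (primrec_dfaoEval (hk.comp hd) (ht.comp hd) (hs.comp hd) (ho.comp hd) hij)
      (primrec_dfaoEval (hk.comp hd) (ht.comp hd) (hs.comp hd) (ho.comp hd)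
        (nat_add.comp hij (fst.comp (snd.comp snd))))

/-- It is decidable, given `k ≥ 2`, a DFAO generating a `k`-automatic sequence
`a`, a rational `r = p/q > 1`, and a length `l ≥ 1`, whether `a` avoids all
factors of the form `x^r` with `|x| ≥ l`; and likewise for `r⁺`-powers. -/
theorem avoidsLongRPowers_decidable :
    ∃ f g : ℕ × List (List ℕ) × ℕ × List ℕ × ℕ × ℕ × ℕ → Bool,
      Computable f ∧ Computable g ∧
      ∀ (k : ℕ) (trans : List (List ℕ)) (q0 : ℕ) (out : List ℕ) (a : ℕ → ℕ)
        (p q l : ℕ),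
        2 ≤ k → dfaoGenerates k trans q0 out a → 1 ≤ q → q < p → 1 ≤ l →
        ((f (k, trans, q0, out, p, q, l) = true ↔
            ∀ (w : List ℕ) (T : ℕ), IsFactorOf a w → l ≤ T →
              ¬ IsRPowerOf p q T w) ∧
         (g (k, trans, q0, out, p, q, l) = true ↔
            ∀ (w : List ℕ) (T : ℕ), IsFactorOf a w → l ≤ T →
              ¬ IsRPlusPowerOf p q T w)) := by
  classical
  refine ⟨_, _, (primrecPred_noSmallRepetition 0).decide.to_comp,
    (primrecPred_noSmallRepetition 1).decide.to_comp, ?_⟩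
  intro k trans q0 out a p q l hk ha hq hp hl
  rw [decide_eq_true_iff, decide_eq_true_iff, noSmallRepetition_iff hk ha hq hp zero_le_one,
    noSmallRepetition_iff hk ha hq hp le_rfl,
    ← exists_factor_period_iff_exists_hasRepetition a 0 hq hp hl,
    ← exists_factor_period_iff_exists_hasRepetition a 1 hq hp hl]
  refine ⟨⟨fun h w T hw hlT hpow => h ⟨w, T, hw, hlT, hpow⟩,
    fun h ⟨w, T, hw, hlT, hpow⟩ => h w T hw hlT hpow⟩, ⟨?_, ?_⟩⟩
  · rintro h w T hw hlT ⟨h₁, h₂, h₃, h₄, h₅⟩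
    exact h ⟨w, T, hw, hlT, h₁, h₂, h₃, h₄, Nat.lt_succ_of_le h₅⟩
  · rintro h ⟨w, T, hw, hlT, h₁, h₂, h₃, h₄, h₅⟩
    exact h w T hw hlT ⟨h₁, h₂, h₃, h₄, Nat.le_of_lt_succ h₅⟩
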